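/- Let k be a field of characteristic zero and B a standard graded artinian k-algebra. Then B ⊗_k k[x]/(x^d) has the strong Lefschetz property for every integer d ≥ 1 if and only if B is almost centered and has the strong Lefschetz property. -/

import Mathlib

open scoped BigOperators

/-- Multiplication by `a` is injective as a map on the subspace `V`. -/
def MulInjOn {k R : Type*} [Field k] [CommRing R] [Algebra k R]
    (V : Submodule k R) (a : R) : Prop :=
  ∀ v ∈ V, a * v = 0 → v = 0

/-- Multiplication by `a` maps the subspace `V` onto the subspace `W`. -/
def MulSurjOnto {k R : Type*} [Field k] [CommRing R] [Algebra k R]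
    (V W : Submodule k R) (a : R) : Prop :=
  ∀ w ∈ W, ∃ v ∈ V, a * v = w

/-- The multiplication map `·a : V → W` has full rank: it is injective or surjective. -/
def MulFullRank {k R : Type*} [Field k] [CommRing R] [Algebra k R]
    (V W : Submodule k R) (a : R) : Prop :=
  MulInjOn V a ∨ MulSurjOnto V W a

/-- `𝒜` is the grading of a standard graded artinian `k`-algebra structure on `R`:
the components form an internal direct sum, vanish in negative degrees, are
multiplicative, the degree-zero part is spanned by `1`, the algebra is generated in
degree one, and `R` is a finite-dimensional `k`-vector space (equivalently, artinian). -/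
structure IsStdGradedArtinian (k : Type*) [Field k] (R : Type*) [CommRing R] [Algebra k R]
    (𝒜 : ℤ → Submodule k R) : Prop where
  internal : DirectSum.IsInternal 𝒜
  one_mem : (1 : R) ∈ 𝒜 0
  mul_mem : ∀ {i j : ℤ} {a b : R}, a ∈ 𝒜 i → b ∈ 𝒜 j → a * b ∈ 𝒜 (i + j)
  neg_bot : ∀ i : ℤ, i < 0 → 𝒜 i = ⊥
  zero_spanOne : 𝒜 0 = Submodule.span k {(1 : R)}
  succ_eq : ∀ i : ℤ, 0 ≤ i → 𝒜 (i + 1) = 𝒜 1 * 𝒜 i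
  finiteDim : FiniteDimensional k R

/-- `A` (graded by `ℬ`) is the extension `B ⊗ₖ k[x]/(x^d)` of `B` (graded by `𝒜`):
`φ` is the canonical inclusion of `B`, `x` has degree one with `x^d = 0`, and each
graded component decomposes as `ℬ j = ⊕_{q=0}^{d-1} x^q · φ(𝒜 (j - q))`. -/
structure IsCIExtension {k B A : Type*} [Field k] [CommRing B] [Algebra k B]
    [CommRing A] [Algebra k A]
    (𝒜 : ℤ → Submodule k B) (ℬ : ℤ → Submodule k A)
    (φ : B →ₐ[k] A) (x : A) (d : ℕ) : Prop where
  map_mem : ∀ (j : ℤ) (b : B), b ∈ 𝒜 j → φ b ∈ ℬ j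
  x_mem : x ∈ ℬ 1
  x_pow : x ^ d = 0
  decomp_mem : ∀ (j : ℤ) (f : Fin d → B), (∀ q : Fin d, f q ∈ 𝒜 (j - ((q : ℕ) : ℤ))) →
    (∑ q : Fin d, x ^ (q : ℕ) * φ (f q)) ∈ ℬ j
  decomp_exists : ∀ (j : ℤ), ∀ c ∈ ℬ j, ∃ f : Fin d → B,
    (∀ q : Fin d, f q ∈ 𝒜 (j - ((q : ℕ) : ℤ))) ∧ c = ∑ q : Fin d, x ^ (q : ℕ) * φ (f q)
  decomp_unique : ∀ (j : ℤ) (f : Fin d → B), (∀ q : Fin d, f q ∈ 𝒜 (j - ((q : ℕ) : ℤ))) →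
    (∑ q : Fin d, x ^ (q : ℕ) * φ (f q)) = 0 → ∀ q : Fin d, f q = 0

/-- `A` (graded by `ℬ`) is the extension `B ⊗ₖ k[x₁,…,xₙ]/(x₁^{d₁},…,xₙ^{dₙ})` of `B`
(graded by `𝒜`). -/
structure IsMultiCIExtension {k B A : Type*} [Field k] [CommRing B] [Algebra k B]
    [CommRing A] [Algebra k A] {n : ℕ}
    (𝒜 : ℤ → Submodule k B) (ℬ : ℤ → Submodule k A)
    (φ : B →ₐ[k] A) (x : Fin n → A) (dv : Fin n → ℕ) : Prop where
  map_mem : ∀ (j : ℤ) (b : B), b ∈ 𝒜 j → φ b ∈ ℬ j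
  x_mem : ∀ m : Fin n, x m ∈ ℬ 1
  x_pow : ∀ m : Fin n, x m ^ dv m = 0
  decomp_mem : ∀ (j : ℤ) (f : ((m : Fin n) → Fin (dv m)) → B),
    (∀ e, f e ∈ 𝒜 (j - ∑ m : Fin n, ((e m : ℕ) : ℤ))) →
    (∑ e : (m : Fin n) → Fin (dv m), (∏ m : Fin n, x m ^ ((e m : ℕ))) * φ (f e)) ∈ ℬ j
  decomp_exists : ∀ (j : ℤ), ∀ c ∈ ℬ j, ∃ f : ((m : Fin n) → Fin (dv m)) → B,
    (∀ e, f e ∈ 𝒜 (j - ∑ m : Fin n, ((e m : ℕ) : ℤ))) ∧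
    c = ∑ e : (m : Fin n) → Fin (dv m), (∏ m : Fin n, x m ^ ((e m : ℕ))) * φ (f e)
  decomp_unique : ∀ (j : ℤ) (f : ((m : Fin n) → Fin (dv m)) → B),
    (∀ e, f e ∈ 𝒜 (j - ∑ m : Fin n, ((e m : ℕ) : ℤ))) →
    (∑ e : (m : Fin n) → Fin (dv m), (∏ m : Fin n, x m ^ ((e m : ℕ))) * φ (f e)) = 0 →
    ∀ e, f e = 0

/-- The weak Lefschetz property. -/
def HasWLP {k R : Type*} [Field k] [CommRing R] [Algebra k R]
    (𝒜 : ℤ → Submodule k R) : Prop :=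
  ∃ ℓ ∈ 𝒜 1, ∀ i : ℤ, 0 ≤ i → MulFullRank (𝒜 i) (𝒜 (i + 1)) ℓ

/-- The strong Lefschetz property. -/
def HasSLP {k R : Type*} [Field k] [CommRing R] [Algebra k R]
    (𝒜 : ℤ → Submodule k R) : Prop :=
  ∃ ℓ ∈ 𝒜 1, ∀ i : ℤ, 0 ≤ i → ∀ t : ℕ, 1 ≤ t → MulFullRank (𝒜 i) (𝒜 (i + t)) (ℓ ^ t)

/-- The Hilbert function of the graded algebra. -/
noncomputable def hilb {k R : Type*} [Field k] [CommRing R] [Algebra k R]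
    (𝒜 : ℤ → Submodule k R) (i : ℤ) : ℕ :=
  Module.finrank k (𝒜 i)

/-- The algebra is almost centered. -/
def AlmostCentered {k R : Type*} [Field k] [CommRing R] [Algebra k R]
    (𝒜 : ℤ → Submodule k R) : Prop :=
  ∀ i j : ℤ, i < j →
    (hilb 𝒜 i < hilb 𝒜 j → ∀ s : ℕ, hilb 𝒜 (i - s) ≤ hilb 𝒜 (j + s)) ∧
    (hilb 𝒜 j < hilb 𝒜 i → ∀ s : ℕ, hilb 𝒜 (j + s) ≤ hilb 𝒜 (i - s))

/-- `binomZ t j` is the binomial coefficient `t` choose `j` for an integer `j`,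
equal to `0` for `j < 0` or `j > t`. -/
def binomZ (t : ℕ) (j : ℤ) : ℤ := if 0 ≤ j then (t.choose j.toNat : ℤ) else 0

/-- The `(d-p) × (d-p)` integer matrix `C_{t,p,d}` whose `(r,c)` entry (with `1 ≤ r,c ≤ d-p`)
is `binom(t, d+1-r-c)`. -/
def Cmat (t p d : ℕ) : Matrix (Fin (d - p)) (Fin (d - p)) ℤ :=
  Matrix.of fun r c => binomZ t ((d : ℤ) - 1 - (r : ℕ) - (c : ℕ))

/-- The characteristic of `k` is zero, or a prime not dividing the integer `N`. -/
def CharCond (k : Type*) [Field k] (N : ℤ) : Prop :=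
  CharZero k ∨ ∃ p : ℕ, p.Prime ∧ CharP k p ∧ ¬ ((p : ℤ) ∣ N)

section Sl2

variable {k W : Type*} [Field k] [AddCommGroup W] [Module k W]

theorem pow_mem_shift {E : Module.End k W} {Q : ℤ → Submodule k W}
    (hE : ∀ j, ∀ w ∈ Q j, E w ∈ Q (j + 1)) (t : ℕ) {j : ℤ} {w : W} (hw : w ∈ Q j) :
    (E ^ t) w ∈ Q (j + t) := by
  induction t with
  | zero => simpa using hw
  | succ t ih =>
    rw [pow_succ', Module.End.mul_apply, Nat.cast_succ, ← add_assoc]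
    exact hE _ _ ih

/-- Raising operators of an `sl₂`-type pair are injective below the middle degree. -/
theorem sl2_pow_injective [CharZero k] {E F : Module.End k W} {Q : ℤ → Submodule k W} {N a : ℤ}
    (hF : ∀ j, ∀ w ∈ Q j, F w ∈ Q (j - 1))
    (hc : ∀ j, ∀ w ∈ Q j, F (E w) = E (F w) + ((N - 2 * j : ℤ) : k) • w)
    (hE : ∀ j, ∀ w ∈ Q j, E w ∈ Q (j + 1))
    (ha : ∀ j < a, Q j = ⊥) {i : ℤ} {t : ℕ} (hit : 2 * i + t ≤ N) {w : W} (hw : w ∈ Q i)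
    (h0 : (E ^ t) w = 0) : w = 0 := by
  have hcomm : ∀ (t : ℕ) (i : ℤ), ∀ w ∈ Q i, F ((E ^ t) w) =
      (E ^ t) (F w) + ((t * (N - 2 * i - t + 1) : ℤ) : k) • (E ^ (t - 1)) w := by
    intro t i w hw
    induction t with
    | zero => simp
    | succ t ih =>
      rw [pow_succ', Module.End.mul_apply, hc _ _ (pow_mem_shift hE t hw), ih, map_add, map_smul,
        ← Module.End.mul_apply, ← pow_succ', add_assoc, Nat.add_sub_cancel]
      congr 1
      rcases t with _ | t
      · simp
      · rw [Nat.add_sub_cancel, ← Module.End.mul_apply, ← pow_succ', ← add_smul]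
        congr 1
        push_cast
        ring
  obtain ⟨n, hn⟩ : ∃ n : ℕ, i < a + n := ⟨(i - a + 1).toNat, by omega⟩
  induction n generalizing i t w with
  | zero =>
    have := ha i (by simpa using hn)
    simpa [this] using hw
  | succ n ihn =>
    have hFw : F w = 0 := by
      refine ihn (i := i - 1) (t := t + 1) (by push_cast; omega) (hF _ _ hw) ?_
        (by push_cast at hn; omega)
      have h1 := hcomm t i w hw
      rw [h0, map_zero] at h1
      have h2 := congrArg E h1
      rw [map_zero, map_add, map_smul] at h2
      rw [pow_succ', Module.End.mul_apply]
      rcases t with _ | t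
      · simpa using h2.symm
      · rw [Nat.add_sub_cancel, ← Module.End.mul_apply E (E ^ t), ← pow_succ', h0, smul_zero,
          add_zero] at h2
        exact h2.symm
    induction t with
    | zero => simpa using h0
    | succ t iht =>
      refine iht (by push_cast at hit; omega) ?_
      have h1 := hcomm (t + 1) i w hw
      rw [h0, hFw, map_zero, map_zero, zero_add] at h1
      refine (smul_eq_zero.mp h1.symm).resolve_left ?_
      refine Int.cast_ne_zero.mpr ?_
      push_cast at hit ⊢
      exact mul_ne_zero (by omega) (by omega)

/-- Raising operators of an `sl₂`-type pair are surjective above the middle degree. -/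
theorem sl2_pow_surjective [CharZero k] {E F : Module.End k W} {Q : ℤ → Submodule k W} {N M : ℤ}
    (hF : ∀ j, ∀ w ∈ Q j, F w ∈ Q (j - 1))
    (hc : ∀ j, ∀ w ∈ Q j, F (E w) = E (F w) + ((N - 2 * j : ℤ) : k) • w)
    (hE : ∀ j, ∀ w ∈ Q j, E w ∈ Q (j + 1))
    (hM : ∀ j, M < j → Q j = ⊥) {i : ℤ} {t : ℕ} (hit : N ≤ 2 * i + t) {w : W}
    (hw : w ∈ Q (i + t)) : ∃ u ∈ Q i, (E ^ t) u = w := by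
  have hFpow : ∀ (r : ℕ) (j : ℤ), ∀ w ∈ Q j, (F ^ r) w ∈ Q (j - r) := by
    intro r j w hw
    induction r with
    | zero => simpa using hw
    | succ r ih =>
      rw [pow_succ', Module.End.mul_apply, Nat.cast_succ, ← sub_sub]
      exact hF _ _ ih
  have hcomm : ∀ (r : ℕ) (j : ℤ), ∀ w ∈ Q j, E w = 0 → E ((F ^ (r + 1)) w) =
      ((-((r + 1) * (N - 2 * j + r)) : ℤ) : k) • (F ^ r) w := by
    intro r j w hw h0
    induction r with
    | zero =>
      have := hc j w hw
      rw [h0, map_zero] at this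
      simp only [zero_add, pow_one, pow_zero, Module.End.one_apply]
      rw [eq_neg_of_add_eq_zero_left this.symm, ← neg_smul]
      congr 1
      push_cast
      ring
    | succ r ih =>
      have h1 := hc _ _ (hFpow (r + 1) j w hw)
      rw [ih, map_smul, ← Module.End.mul_apply, ← pow_succ'] at h1
      rw [pow_succ' F (r + 1), Module.End.mul_apply, ← sub_eq_iff_eq_add.mpr h1, ← sub_smul]
      congr 1
      push_cast
      ring
  obtain ⟨n, hn⟩ : ∃ n : ℕ, M < i + t + n := ⟨(M - i - t + 1).toNat, by omega⟩
  induction n generalizing i t w with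
  | zero =>
    have := hM (i + t) (by simpa using hn)
    rw [this, Submodule.mem_bot] at hw
    exact ⟨0, zero_mem _, by simp [hw]⟩
  | succ n ihn =>
    have hEw : E w ∈ Q ((i - 1) + ((t + 2 : ℕ) : ℤ)) := by
      have := hE _ _ hw
      convert this using 2
      push_cast; ring
    obtain ⟨u, hu, hu'⟩ := ihn (i := i - 1) (t := t + 2) (by push_cast; omega) hEw
      (by push_cast at hn ⊢; omega)
    have hEu : E u ∈ Q i := by simpa using hE _ _ hu
    set w' := w - (E ^ t) (E u) with hw'
    have hw'Q : w' ∈ Q (i + t) := sub_mem hw (pow_mem_shift hE t hEu)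
    have hEw' : E w' = 0 := by
      rw [hw', map_sub, ← hu', sub_eq_zero, pow_succ, pow_succ']
      rfl
    have key : ∀ r : ℕ, r ≤ t → ∃ c : k, c ≠ 0 ∧ (E ^ r) ((F ^ r) w') = c • w' := by
      intro r
      induction r with
      | zero => exact fun _ => ⟨1, one_ne_zero, by simp⟩
      | succ r ih =>
        intro hr
        obtain ⟨c, hc0, hc1⟩ := ih (by omega)
        refine ⟨((-((r + 1) * (N - 2 * (i + t) + r)) : ℤ) : k) * c, mul_ne_zero ?_ hc0, ?_⟩
        · rw [Int.cast_ne_zero, neg_ne_zero]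
          exact mul_ne_zero (by omega) (by omega)
        · rw [pow_succ E, Module.End.mul_apply, hcomm r _ w' hw'Q hEw', map_smul, hc1, smul_smul]
    obtain ⟨c, hc0, hc1⟩ := key t le_rfl
    refine ⟨E u + c⁻¹ • (F ^ t) w', add_mem hEu (Submodule.smul_mem _ _ ?_), ?_⟩
    · simpa using hFpow t _ w' hw'Q
    · rw [map_add, map_smul, hc1, smul_smul, inv_mul_cancel₀ hc0, one_smul, hw']
      abel

end Sl2

section Strings

variable {k W : Type*} [Field k] [AddCommGroup W] [Module k W]

/-- `P` is the family of projections onto the components of a grading `𝒲`. -/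
structure IsGradedProj (𝒲 : ℤ → Submodule k W) (P : ℤ → W →ₗ[k] W) : Prop where
  mem : ∀ j w, P j w ∈ 𝒲 j
  of_mem : ∀ j, ∀ w ∈ 𝒲 j, P j w = w
  of_mem_ne : ∀ i j, i ≠ j → ∀ w ∈ 𝒲 i, P j w = 0
  exists_sum : ∀ w, ∃ S : Finset ℤ, ∑ j ∈ S, P j w = w

theorem DirectSum.IsInternal.exists_isGradedProj {𝒲 : ℤ → Submodule k W}
    (h : DirectSum.IsInternal 𝒲) : ∃ P : ℤ → W →ₗ[k] W, IsGradedProj 𝒲 P := by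
  classical
  let := h.chooseDecomposition
  refine ⟨fun j => (𝒲 j).subtype ∘ₗ DirectSum.component k ℤ (fun i => 𝒲 i) j ∘ₗ
    (DirectSum.decomposeLinearEquiv 𝒲).toLinearMap, ?_, ?_, ?_, ?_⟩
  · intro j w
    exact SetLike.coe_mem _
  · intro j w hw
    exact DirectSum.decompose_of_mem_same 𝒲 hw
  · intro i j hij w hw
    exact DirectSum.decompose_of_mem_ne 𝒲 hw hij
  · intro w
    exact ⟨_, DirectSum.sum_support_decompose 𝒲 w⟩

variable {𝒲 : ℤ → Submodule k W} {P : ℤ → W →ₗ[k] W}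

theorem IsGradedProj.apply_of_mem (hP : IsGradedProj 𝒲 P) {i : ℤ} {w : W} (hw : w ∈ 𝒲 i) (j : ℤ) :
    P j w = if i = j then w else 0 := by
  split_ifs with h
  · exact hP.of_mem j w (h ▸ hw)
  · exact hP.of_mem_ne i j h w hw

theorem IsGradedProj.comm_pow (hP : IsGradedProj 𝒲 P) {E : Module.End k W}
    (hE : ∀ j, ∀ w ∈ 𝒲 j, E w ∈ 𝒲 (j + 1)) (t : ℕ) (j : ℤ) (w : W) :
    P (j + t) ((E ^ t) w) = (E ^ t) (P j w) := by
  obtain ⟨S, hS⟩ := hP.exists_sum w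
  have hterm : ∀ i, P (j + t) ((E ^ t) (P i w)) = (E ^ t) (P j (P i w)) := by
    intro i
    rw [hP.apply_of_mem (hP.mem i w) j, hP.apply_of_mem (pow_mem_shift hE t (hP.mem i w))]
    by_cases h : i = j <;> simp [h]
  calc P (j + t) ((E ^ t) w) = P (j + t) ((E ^ t) (∑ i ∈ S, P i w)) := by rw [hS]
    _ = (E ^ t) (P j (∑ i ∈ S, P i w)) := by simp only [map_sum, hterm]
    _ = _ := by rw [hS]

/-- A homogeneous Jordan basis of the subspace `C`: the vectors `E ^ p (gen s)`, `p < len s`, form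
a basis of `C`, and `gen s` is homogeneous of degree `start s`. -/
structure StringBasis (𝒲 : ℤ → Submodule k W) (E : Module.End k W) (C : Submodule k W)
    (ι : Type) where
  start : ι → ℤ
  len : ι → ℕ
  gen : ι → W
  len_pos : ∀ s, 0 < len s
  gen_mem : ∀ s, gen s ∈ 𝒲 (start s)
  pow_len : ∀ s, (E ^ len s) (gen s) = 0
  linInd : LinearIndependent k
    (fun t : Σ s, Fin (len s) => (E ^ (t.2 : ℕ)) (gen t.1))
  span_eq : Submodule.span k
    (Set.range (fun t : Σ s, Fin (len s) => (E ^ (t.2 : ℕ)) (gen t.1))) = C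

/-- A homogeneous string of maximal length splits off. -/
theorem exists_string_complement (hP : IsGradedProj 𝒲 P) {E : Module.End k W}
    (hE : ∀ j, ∀ w ∈ 𝒲 j, E w ∈ 𝒲 (j + 1)) (hnil : IsNilpotent E) {C : Submodule k W}
    (hC0 : C ≠ ⊥) (hCE : ∀ w ∈ C, E w ∈ C) (hCP : ∀ j, ∀ w ∈ C, P j w ∈ C) :
    ∃ (a : ℤ) (m : ℕ) (v : W) (C' : Submodule k W), 0 < m ∧ v ∈ 𝒲 a ∧ (E ^ m) v = 0 ∧
      LinearIndependent k (fun p : Fin m => (E ^ (p : ℕ)) v) ∧ C' < C ∧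
      (∀ w ∈ C', E w ∈ C') ∧ (∀ j, ∀ w ∈ C', P j w ∈ C') ∧
      Disjoint (Submodule.span k (Set.range fun p : Fin m => (E ^ (p : ℕ)) v)) C' ∧
      Submodule.span k (Set.range fun p : Fin m => (E ^ (p : ℕ)) v) ⊔ C' = C := by
  classical
  have hex : ∃ m : ℕ, ∀ w ∈ C, (E ^ m) w = 0 := by
    obtain ⟨m, hm⟩ := hnil
    exact ⟨m, fun w _ => by rw [hm]; rfl⟩
  obtain ⟨m, hm, hmin⟩ : ∃ m, (∀ w ∈ C, (E ^ m) w = 0) ∧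
      ∀ m' < m, ¬ ∀ w ∈ C, (E ^ m') w = 0 :=
    ⟨Nat.find hex, Nat.find_spec hex, fun m' h => Nat.find_min hex h⟩
  have hm0 : 0 < m := by
    rw [Nat.pos_iff_ne_zero]
    rintro rfl
    exact hC0 ((Submodule.eq_bot_iff _).mpr fun w hw => by simpa using hm w hw)
  obtain ⟨a, v, hvC, hva, hv0⟩ : ∃ a, ∃ v ∈ C, v ∈ 𝒲 a ∧ (E ^ (m - 1)) v ≠ 0 := by
    by_contra! hcon
    refine hmin (m - 1) (by omega) fun w hw => ?_
    obtain ⟨S, hS⟩ := hP.exists_sum w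
    rw [← hS, map_sum]
    exact Finset.sum_eq_zero fun j _ => hcon j _ (hCP j w hw) (hP.mem j w)
  obtain ⟨lam₀, hlam₀⟩ : ∃ f : Module.Dual k W, f ((E ^ (m - 1)) v) ≠ 0 := by
    by_contra! hcon
    exact hv0 ((Module.forall_dual_apply_eq_zero_iff k _).mp hcon)
  set top : ℤ := a + ((m - 1 : ℕ) : ℤ) with htop
  set lam : W →ₗ[k] k := (lam₀ ((E ^ (m - 1)) v))⁻¹ • (lam₀ ∘ₗ P top) with hlam
  have hlamv : ∀ n : ℕ, lam ((E ^ n) v) = if n = m - 1 then 1 else 0 := by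
    intro n
    simp only [hlam, LinearMap.smul_apply, LinearMap.comp_apply,
      hP.apply_of_mem (pow_mem_shift hE n hva)]
    by_cases h : n = m - 1
    · subst h
      simp [htop, hlam₀]
    · rw [if_neg, if_neg h, map_zero, smul_zero]
      omega
  have hEpow : ∀ n : ℕ, ∀ w ∈ C, (E ^ n) w ∈ C := by
    intro n w hw
    induction n with
    | zero => simpa using hw
    | succ n ih => rw [pow_succ', Module.End.mul_apply]; exact hCE _ ih
  have hbig : ∀ n, m ≤ n → ∀ w ∈ C, (E ^ n) w = 0 := by
    intro n hn w hw
    rw [← Nat.sub_add_cancel hn, pow_add, Module.End.mul_apply, hm w hw, map_zero]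
  let C' : Submodule k W := C ⊓ ⨅ n : ℕ, LinearMap.ker (lam ∘ₗ E ^ n)
  have hC' : ∀ w, w ∈ C' ↔ w ∈ C ∧ ∀ n : ℕ, lam ((E ^ n) w) = 0 := by
    intro w
    simp [C', Submodule.mem_inf, Submodule.mem_iInf]
  have hcoef : ∀ (c : Fin m → k) (r : Fin m),
      lam ((E ^ (m - 1 - (r : ℕ))) (∑ p, c p • (E ^ (p : ℕ)) v)) = c r := by
    intro c r
    simp only [map_sum, map_smul, ← Module.End.mul_apply, ← pow_add, hlamv, smul_eq_mul, mul_ite,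
      mul_one, mul_zero]
    rw [Finset.sum_eq_single r]
    · rw [if_pos (by omega)]
    · intro p _ hp
      rw [if_neg]
      intro h
      exact hp (Fin.ext (by omega))
    · simp
  refine ⟨a, m, v, C', hm0, hva, hm v hvC, ?_, ?_, ?_, ?_, ?_, ?_⟩
  · rw [Fintype.linearIndependent_iff]
    intro c hc r
    rw [← hcoef c r, hc, map_zero, map_zero]
  · refine lt_of_le_of_ne inf_le_left fun h => ?_
    have h1 := ((hC' v).mp (h ▸ hvC)).2 (m - 1)
    rw [hlamv, if_pos rfl] at h1
    exact one_ne_zero h1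
  · intro w hw
    rw [hC'] at hw ⊢
    refine ⟨hCE w hw.1, fun n => ?_⟩
    rw [← Module.End.mul_apply, ← pow_succ]
    exact hw.2 _
  · intro j w hw
    rw [hC'] at hw ⊢
    refine ⟨hCP j w hw.1, fun n => ?_⟩
    have h1 := hw.2 n
    simp only [hlam, LinearMap.smul_apply, LinearMap.comp_apply] at h1 ⊢
    rw [← hP.comm_pow hE, hP.apply_of_mem (hP.mem _ _)]
    split_ifs with h
    · rw [h, h1]
    · simp
  · rw [Submodule.disjoint_def]
    intro w hw hw'
    obtain ⟨c, rfl⟩ := (Submodule.mem_span_range_iff_exists_fun k).mp hw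
    refine Finset.sum_eq_zero fun r _ => ?_
    rw [← hcoef c r, ((hC' _).mp hw').2, zero_smul]
  · refine le_antisymm (sup_le ?_ inf_le_left) fun w hw => ?_
    · rw [Submodule.span_le]
      rintro _ ⟨p, rfl⟩
      exact hEpow p v hvC
    · set c : Fin m → k := fun p => lam ((E ^ (m - 1 - (p : ℕ))) w) with hc
      have hmem : ∑ p, c p • (E ^ (p : ℕ)) v ∈
          Submodule.span k (Set.range fun p : Fin m => (E ^ (p : ℕ)) v) :=
        (Submodule.mem_span_range_iff_exists_fun k).mpr ⟨c, rfl⟩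
      have hmemC : ∑ p, c p • (E ^ (p : ℕ)) v ∈ C :=
        Submodule.sum_mem _ fun p _ => Submodule.smul_mem _ _ (hEpow p v hvC)
      rw [← add_sub_cancel (∑ p, c p • (E ^ (p : ℕ)) v) w]
      refine Submodule.add_mem_sup hmem ((hC' _).mpr ⟨sub_mem hw hmemC, fun n => ?_⟩)
      rcases lt_or_ge n m with hn | hn
      · have h1 := hcoef c ⟨m - 1 - n, by omega⟩
        have h2 : m - 1 - (m - 1 - n) = n := by omega
        simp only [h2] at h1
        rw [map_sub, map_sub, h1, hc]
        simp [h2]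
      · rw [hbig n hn _ (sub_mem hw hmemC), map_zero]

/-- Graded Jordan normal form. -/
theorem exists_stringBasis [FiniteDimensional k W] (hP : IsGradedProj 𝒲 P) {E : Module.End k W}
    (hE : ∀ j, ∀ w ∈ 𝒲 j, E w ∈ 𝒲 (j + 1)) (hnil : IsNilpotent E) (C : Submodule k W)
    (hCE : ∀ w ∈ C, E w ∈ C) (hCP : ∀ j, ∀ w ∈ C, P j w ∈ C) :
    ∃ (ι : Type) (_ : Fintype ι), Nonempty (StringBasis 𝒲 E C ι) := by
  induction C using WellFoundedLT.induction with
  | ind C ih =>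
  by_cases hC0 : C = ⊥
  · subst hC0
    exact ⟨Empty, inferInstance, ⟨⟨nofun, nofun, nofun, nofun, nofun, nofun,
      linearIndependent_empty_type, by rw [Set.range_eq_empty, Submodule.span_empty]⟩⟩⟩
  obtain ⟨a, m, v, C', hm, hva, hv0, hind, hlt, hC'E, hC'P, hdisj, hsup⟩ :=
    exists_string_complement hP hE hnil hC0 hCE hCP
  obtain ⟨ι, _, ⟨b⟩⟩ := ih C' hlt hC'E hC'P
  let e : (Σ s : Unit ⊕ ι, Fin (Sum.elim (fun _ => m) b.len s)) ≃
      Fin m ⊕ Σ s, Fin (b.len s) :=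
    (Equiv.sumSigmaDistrib _).trans
      (Equiv.sumCongr (Equiv.uniqueSigma fun _ : Unit => Fin m) (Equiv.refl _))
  have hfam : (fun t : Σ s : Unit ⊕ ι, Fin (Sum.elim (fun _ => m) b.len s) =>
      (E ^ (t.2 : ℕ)) (Sum.elim (fun _ => v) b.gen t.1)) =
      Sum.elim (fun p : Fin m => (E ^ (p : ℕ)) v)
        (fun t : Σ s, Fin (b.len s) => (E ^ (t.2 : ℕ)) (b.gen t.1)) ∘ e := by
    funext t
    rcases t with ⟨_ | s, p⟩ <;> rfl
  refine ⟨Unit ⊕ ι, inferInstance, ⟨⟨Sum.elim (fun _ => a) b.start, Sum.elim (fun _ => m) b.len,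
    Sum.elim (fun _ => v) b.gen, ?_, ?_, ?_, ?_, ?_⟩⟩⟩
  · rintro (_ | s)
    exacts [hm, b.len_pos s]
  · rintro (_ | s)
    exacts [hva, b.gen_mem s]
  · rintro (_ | s)
    exacts [hv0, b.pow_len s]
  · rw [hfam]
    refine LinearIndependent.comp ?_ e e.injective
    refine hind.sum_type b.linInd ?_
    rwa [b.span_eq]
  · rw [hfam, e.surjective.range_comp, Set.Sum.elim_range, Submodule.span_union, b.span_eq, hsup]

end Strings
section StringTensor

variable {k W : Type*} [Field k] [AddCommGroup W] [Module k W]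

theorem IsGradedProj.eq_span {𝒲 : ℤ → Submodule k W} {P : ℤ → W →ₗ[k] W} (hP : IsGradedProj 𝒲 P)
    {I : Type*} (b : Module.Basis I k W) (deg : I → ℤ) (hb : ∀ i, b i ∈ 𝒲 (deg i)) (j : ℤ) :
    𝒲 j = Submodule.span k (Set.range fun i : {i // deg i = j} => b i) := by
  refine le_antisymm (fun w hw => ?_) ?_
  · have h : ∀ w, P j w ∈ Submodule.span k (Set.range fun i : {i // deg i = j} => b i) := by
      intro w
      induction b.mem_span w using Submodule.span_induction with
      | mem _ h =>
        obtain ⟨i, rfl⟩ := h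
        rw [hP.apply_of_mem (hb i)]
        split_ifs with h
        · exact Submodule.subset_span ⟨⟨i, h⟩, rfl⟩
        · exact zero_mem _
      | zero => rw [map_zero]; exact zero_mem _
      | add x y _ _ hx hy => rw [map_add]; exact add_mem hx hy
      | smul c x _ hx => rw [map_smul]; exact Submodule.smul_mem _ _ hx
    have := h w
    rwa [hP.of_mem j w hw] at this
  · rw [Submodule.span_le]
    rintro _ ⟨⟨i, rfl⟩, rfl⟩
    exact hb i

/-- A decomposition of a graded space with a degree-one endomorphism into tensor products
of strings: `vec s p q` plays the role of `z ^ p * x ^ q` in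
`k[z, x] / (z ^ len s, x ^ d)` shifted by `start s`, and `E` of multiplication by `z + x`. -/
structure StringTensor (𝒲 : ℤ → Submodule k W) (E : Module.End k W) (ι : Type) (d : ℕ) where
  start : ι → ℤ
  len : ι → ℕ
  vec : ι → ℕ → ℕ → W
  vec_mem : ∀ s (p q : ℕ), vec s p q ∈ 𝒲 (start s + p + q)
  vec_left : ∀ s p q, len s ≤ p → vec s p q = 0
  vec_right : ∀ s p q, d ≤ q → vec s p q = 0
  map_vec : ∀ s p q, E (vec s p q) = vec s (p + 1) q + vec s p (q + 1)
  basis : Module.Basis (Σ s, Fin (len s) × Fin d) k W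
  basis_apply : ∀ t, basis t = vec t.1 t.2.1 t.2.2

namespace StringTensor

variable {𝒲 : ℤ → Submodule k W} {E : Module.End k W} {ι : Type} {d : ℕ}
  (T : StringTensor 𝒲 E ι d)

/-- The degree `j` part of the summand indexed by `s`. -/
def piece (s : ι) (j : ℤ) : Submodule k W :=
  Submodule.span k {w | ∃ p q : ℕ, T.start s + p + q = j ∧ w = T.vec s p q}

/-- The lowering operator. -/
noncomputable def lower : W →ₗ[k] W :=
  T.basis.constr k fun t =>
    (((t.2.1 : ℕ) * (T.len t.1 - (t.2.1 : ℕ)) : ℤ) : k) • T.vec t.1 ((t.2.1 : ℕ) - 1) t.2.2 +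
    (((t.2.2 : ℕ) * (d - (t.2.2 : ℕ)) : ℤ) : k) • T.vec t.1 t.2.1 ((t.2.2 : ℕ) - 1)

open Classical in
/-- The projection onto the summand indexed by `s`. -/
noncomputable def proj (s : ι) : W →ₗ[k] W :=
  T.basis.constr k fun t => if t.1 = s then T.basis t else 0

/-- Twice the degree in which the summand indexed by `s` is centered. -/
def center (s : ι) : ℤ := 2 * T.start s + T.len s + d - 2

theorem vec_eq_basis {s : ι} {p q : ℕ} (hp : p < T.len s) (hq : q < d) :
    T.vec s p q = T.basis ⟨s, ⟨p, hp⟩, ⟨q, hq⟩⟩ :=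
  (T.basis_apply ⟨s, ⟨p, hp⟩, ⟨q, hq⟩⟩).symm

theorem lower_vec {s : ι} {p q : ℕ} (hp : p ≤ T.len s) (hq : q ≤ d) :
    T.lower (T.vec s p q) = ((p * (T.len s - p) : ℤ) : k) • T.vec s (p - 1) q +
      ((q * (d - q) : ℤ) : k) • T.vec s p (q - 1) := by
  rcases hp.lt_or_eq with hp | rfl
  · rcases hq.lt_or_eq with hq | rfl
    · rw [T.vec_eq_basis hp hq, lower, Module.Basis.constr_basis]
    · simp [T.vec_right]
  · simp [T.vec_left]

theorem proj_vec_self (s : ι) (p q : ℕ) : T.proj s (T.vec s p q) = T.vec s p q := by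
  by_cases hp : p < T.len s
  · by_cases hq : q < d
    · rw [T.vec_eq_basis hp hq, proj, Module.Basis.constr_basis, if_pos rfl]
    · simp [T.vec_right s p q (not_lt.mp hq)]
  · simp [T.vec_left s p q (not_lt.mp hp)]

theorem proj_vec_ne {s s' : ι} (h : s' ≠ s) (p q : ℕ) : T.proj s (T.vec s' p q) = 0 := by
  by_cases hp : p < T.len s'
  · by_cases hq : q < d
    · rw [T.vec_eq_basis hp hq, proj, Module.Basis.constr_basis, if_neg h]
    · simp [T.vec_right s' p q (not_lt.mp hq)]
  · simp [T.vec_left s' p q (not_lt.mp hp)]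

theorem proj_map (s : ι) (w : W) : T.proj s (E w) = E (T.proj s w) := by
  have : T.proj s ∘ₗ E = E ∘ₗ T.proj s := by
    refine T.basis.ext fun t => ?_
    rw [LinearMap.comp_apply, LinearMap.comp_apply, T.basis_apply, T.map_vec, map_add]
    by_cases h : t.1 = s
    · subst h
      simp only [proj_vec_self, T.map_vec]
    · simp only [T.proj_vec_ne h, map_zero, add_zero]
  exact LinearMap.congr_fun this w

theorem proj_pow (s : ι) (t : ℕ) (w : W) : T.proj s ((E ^ t) w) = (E ^ t) (T.proj s w) := by
  induction t with
  | zero => rfl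
  | succ t ih => rw [pow_succ', Module.End.mul_apply, Module.End.mul_apply, proj_map, ih]

theorem sum_proj [Fintype ι] (w : W) : ∑ s, T.proj s w = w := by
  classical
  have : ∑ s, T.proj s = LinearMap.id := by
    refine T.basis.ext fun t => ?_
    rw [LinearMap.sum_apply, Finset.sum_eq_single t.1, T.basis_apply, proj_vec_self]
    · rfl
    · intro s _ hs
      rw [T.basis_apply, T.proj_vec_ne hs.symm]
    · simp
  rw [← LinearMap.sum_apply, this, LinearMap.id_apply]

theorem vec_mem_piece {s : ι} {p q : ℕ} {j : ℤ} (h : T.start s + p + q = j) :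
    T.vec s p q ∈ T.piece s j := Submodule.subset_span ⟨p, q, h, rfl⟩

theorem piece_le (s : ι) (j : ℤ) : T.piece s j ≤ 𝒲 j := by
  rw [piece, Submodule.span_le]
  rintro _ ⟨p, q, rfl, rfl⟩
  exact T.vec_mem s p q

theorem proj_of_mem_piece {s : ι} {j : ℤ} {w : W} (hw : w ∈ T.piece s j) : T.proj s w = w := by
  induction hw using Submodule.span_induction with
  | mem x hx => obtain ⟨p, q, -, rfl⟩ := hx; exact T.proj_vec_self s p q
  | zero => simp
  | add x y _ _ hx hy => rw [map_add, hx, hy]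
  | smul c x _ hx => rw [map_smul, hx]

theorem proj_mem_piece {P : ℤ → W →ₗ[k] W} (hP : IsGradedProj 𝒲 P) (s : ι) {j : ℤ} {w : W}
    (hw : w ∈ 𝒲 j) : T.proj s w ∈ T.piece s j := by
  rw [hP.eq_span T.basis (fun t => T.start t.1 + (t.2.1 : ℕ) + (t.2.2 : ℕ))
    (fun t => by rw [T.basis_apply]; exact T.vec_mem _ _ _)] at hw
  induction hw using Submodule.span_induction with
  | mem x hx =>
    obtain ⟨⟨t, rfl⟩, rfl⟩ := hx
    simp only [T.basis_apply]
    by_cases h : t.1 = s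
    · subst h
      rw [proj_vec_self]
      exact T.vec_mem_piece rfl
    · rw [T.proj_vec_ne h]
      exact zero_mem _
  | zero => simp
  | add x y _ _ hx hy => rw [map_add]; exact add_mem hx hy
  | smul c x _ hx => rw [map_smul]; exact Submodule.smul_mem _ _ hx

theorem map_mem_piece (s : ι) (j : ℤ) : ∀ w ∈ T.piece s j, E w ∈ T.piece s (j + 1) := by
  intro w hw
  induction hw using Submodule.span_induction with
  | mem x hx =>
    obtain ⟨p, q, rfl, rfl⟩ := hx
    rw [T.map_vec]
    exact add_mem (T.vec_mem_piece (by push_cast; ring)) (T.vec_mem_piece (by push_cast; ring))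
  | zero => simp
  | add x y _ _ hx hy => rw [map_add]; exact add_mem hx hy
  | smul c x _ hx => rw [map_smul]; exact Submodule.smul_mem _ _ hx

theorem lower_mem_piece (s : ι) (j : ℤ) : ∀ w ∈ T.piece s j, T.lower w ∈ T.piece s (j - 1) := by
  intro w hw
  induction hw using Submodule.span_induction with
  | mem x hx =>
    obtain ⟨p, q, rfl, rfl⟩ := hx
    by_cases hp : T.len s ≤ p
    · simp [T.vec_left s p q hp]
    by_cases hq : d ≤ q
    · simp [T.vec_right s p q hq]
    rw [T.lower_vec (by omega) (by omega)]
    refine add_mem ?_ ?_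
    · rcases p with _ | p
      · simp
      · exact Submodule.smul_mem _ _ (T.vec_mem_piece (by omega))
    · rcases q with _ | q
      · simp
      · exact Submodule.smul_mem _ _ (T.vec_mem_piece (by omega))
  | zero => simp
  | add x y _ _ hx hy => rw [map_add]; exact add_mem hx hy
  | smul c x _ hx => rw [map_smul]; exact Submodule.smul_mem _ _ hx

theorem lower_map (s : ι) (j : ℤ) : ∀ w ∈ T.piece s j,
    T.lower (E w) = E (T.lower w) + ((T.center s - 2 * j : ℤ) : k) • w := by
  intro w hw
  induction hw using Submodule.span_induction with
  | mem x hx =>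
    obtain ⟨p, q, rfl, rfl⟩ := hx
    by_cases hp : T.len s ≤ p
    · simp [T.vec_left s p q hp]
    by_cases hq : d ≤ q
    · simp [T.vec_right s p q hq]
    have e1 : E (((p * (T.len s - p) : ℤ) : k) • T.vec s (p - 1) q) =
        ((p * (T.len s - p) : ℤ) : k) • (T.vec s p q + T.vec s (p - 1) (q + 1)) := by
      rcases p with _ | p
      · simp
      · rw [map_smul, T.map_vec, Nat.add_sub_cancel]
    have e2 : E (((q * (d - q) : ℤ) : k) • T.vec s p (q - 1)) =
        ((q * (d - q) : ℤ) : k) • (T.vec s (p + 1) (q - 1) + T.vec s p q) := by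
      rcases q with _ | q
      · simp
      · rw [map_smul, T.map_vec, Nat.add_sub_cancel]
    rw [T.map_vec, map_add, T.lower_vec (by omega) (by omega), T.lower_vec (by omega) (by omega),
      T.lower_vec (by omega) (by omega), map_add, e1, e2, center]
    simp only [Nat.add_sub_cancel]
    push_cast
    module
  | zero => simp
  | add x y _ _ hx hy => simp only [map_add, smul_add, hx, hy]; abel
  | smul c x _ hx => simp only [map_smul, hx, smul_add, smul_comm c]

theorem piece_eq_bot_of_lt {s : ι} {j : ℤ} (h : j < T.start s) : T.piece s j = ⊥ := by
  rw [piece, Submodule.span_eq_bot]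
  rintro _ ⟨p, q, h1, rfl⟩
  omega

theorem piece_eq_bot_of_gt {s : ι} {j : ℤ} (h : T.start s + T.len s + d < j) :
    T.piece s j = ⊥ := by
  rw [piece, Submodule.span_eq_bot]
  rintro _ ⟨p, q, h1, rfl⟩
  by_cases hp : T.len s ≤ p
  · exact T.vec_left _ _ _ hp
  · exact T.vec_right _ _ _ (by omega)

theorem pow_injective [Fintype ι] [CharZero k] {P : ℤ → W →ₗ[k] W} (hP : IsGradedProj 𝒲 P) {i : ℤ} {t : ℕ}
    (h : ∀ s, 2 * i + t ≤ T.center s) {w : W} (hw : w ∈ 𝒲 i) (h0 : (E ^ t) w = 0) : w = 0 := by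
  rw [← T.sum_proj w]
  refine Finset.sum_eq_zero fun s _ => ?_
  refine sl2_pow_injective (T.lower_mem_piece s) (T.lower_map s) (T.map_mem_piece s)
    (fun j hj => T.piece_eq_bot_of_lt hj) (h s) (T.proj_mem_piece hP s hw) ?_
  rw [← proj_pow, h0, map_zero]

theorem pow_surjective [Fintype ι] [CharZero k] {P : ℤ → W →ₗ[k] W} (hP : IsGradedProj 𝒲 P) {i : ℤ} {t : ℕ}
    (h : ∀ s, T.center s ≤ 2 * i + t) {w : W} (hw : w ∈ 𝒲 (i + t)) :
    ∃ u ∈ 𝒲 i, (E ^ t) u = w := by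
  have key : ∀ s, ∃ u ∈ T.piece s i, (E ^ t) u = T.proj s w := fun s =>
    sl2_pow_surjective (T.lower_mem_piece s) (T.lower_map s) (T.map_mem_piece s)
      (fun j hj => T.piece_eq_bot_of_gt hj) (h s) (T.proj_mem_piece hP s hw)
  choose u hu hu' using key
  refine ⟨∑ s, u s, Submodule.sum_mem _ fun s _ => T.piece_le s i (hu s), ?_⟩
  rw [map_sum]
  simp only [hu', sum_proj]

/-- The dimension of the degree `j` part of the summand indexed by `s`. -/
def pieceDim (s : ι) (j : ℤ) : ℕ :=
  (min (T.len s : ℤ) (j - T.start s + 1) - max 0 (j - T.start s - d + 1)).toNat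

theorem finrank_piece (s : ι) (j : ℤ) : Module.finrank k (T.piece s j) = T.pieceDim s j := by
  set S : Finset ℕ := Finset.Ico (max 0 (j - T.start s - d + 1)).toNat
    (min (T.len s : ℤ) (j - T.start s + 1)).toNat with hS
  have hSmem : ∀ p, p ∈ S ↔ p < T.len s ∧ T.start s + p ≤ j ∧ j < T.start s + p + d := by
    intro p
    rw [hS, Finset.mem_Ico]
    omega
  let g : S → Σ s, Fin (T.len s) × Fin d := fun p =>
    ⟨s, ⟨p, ((hSmem p).mp p.2).1⟩, ⟨(j - T.start s - (p : ℕ)).toNat, by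
      have := (hSmem p).mp p.2
      omega⟩⟩
  have hg : Function.Injective g := by
    intro p p' h
    simp only [g, Sigma.mk.injEq, heq_eq_eq, true_and, Prod.mk.injEq, Fin.mk.injEq] at h
    exact Subtype.ext h.1
  have hspan : T.piece s j = Submodule.span k (Set.range (T.basis ∘ g)) := by
    refine le_antisymm ?_ ?_
    · rw [piece, Submodule.span_le]
      rintro _ ⟨p, q, h, rfl⟩
      by_cases hp : p < T.len s
      · by_cases hq : q < d
        · refine Submodule.subset_span ⟨⟨p, (hSmem p).mpr (by omega)⟩, ?_⟩
          simp only [Function.comp_apply, g, T.basis_apply]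
          congr
          omega
        · rw [T.vec_right s p q (not_lt.mp hq)]
          exact zero_mem _
      · rw [T.vec_left s p q (not_lt.mp hp)]
        exact zero_mem _
    · rw [Submodule.span_le]
      rintro _ ⟨p, rfl⟩
      simp only [Function.comp_apply, g, T.basis_apply]
      have := (hSmem p).mp p.2
      exact T.vec_mem_piece (by omega)
  rw [hspan, finrank_span_eq_card (T.basis.linearIndependent.comp g hg), Fintype.card_coe, hS,
    Nat.card_Ico, pieceDim]
  omega

theorem pieceDim_le_of_injective [FiniteDimensional k W] {i : ℤ} {t : ℕ}
    (h : ∀ w ∈ 𝒲 i, (E ^ t) w = 0 → w = 0) (s : ι) :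
    T.pieceDim s i ≤ T.pieceDim s (i + t) := by
  rw [← finrank_piece, ← finrank_piece]
  have hmaps : ∀ w ∈ T.piece s i, (E ^ t) w ∈ T.piece s (i + t) := fun w hw =>
    pow_mem_shift (T.map_mem_piece s) t hw
  refine LinearMap.finrank_le_finrank_of_injective (f := (E ^ t).restrict hmaps) ?_
  rw [← LinearMap.ker_eq_bot, LinearMap.ker_eq_bot']
  rintro ⟨w, hw⟩ h0
  exact Subtype.ext (h w (T.piece_le s i hw) (congrArg Subtype.val h0))

theorem pieceDim_le_of_surjective [FiniteDimensional k W] {P : ℤ → W →ₗ[k] W}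
    (hP : IsGradedProj 𝒲 P) {i : ℤ} {t : ℕ}
    (h : ∀ w ∈ 𝒲 (i + t), ∃ u ∈ 𝒲 i, (E ^ t) u = w) (s : ι) :
    T.pieceDim s (i + t) ≤ T.pieceDim s i := by
  rw [← finrank_piece, ← finrank_piece]
  have hmaps : ∀ w ∈ T.piece s i, (E ^ t) w ∈ T.piece s (i + t) := fun w hw =>
    pow_mem_shift (T.map_mem_piece s) t hw
  refine LinearMap.finrank_le_finrank_of_surjective (f := (E ^ t).restrict hmaps) ?_
  rintro ⟨w, hw⟩
  obtain ⟨u, hu, hu'⟩ := h w (T.piece_le s _ hw)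
  refine ⟨⟨T.proj s u, T.proj_mem_piece hP s hu⟩, Subtype.ext ?_⟩
  change (E ^ t) (T.proj s u) = w
  rw [← proj_pow, hu', T.proj_of_mem_piece hw]

end StringTensor

end StringTensor
section Extension

variable {k B A : Type*} [Field k] [CommRing B] [Algebra k B] [CommRing A] [Algebra k A]
  {𝒜 : ℤ → Submodule k B} {ℬ : ℤ → Submodule k A}

theorem IsStdGradedArtinian.mulLeft_mem (hB : IsStdGradedArtinian k B 𝒜) {ℓ : B}
    (hℓ : ℓ ∈ 𝒜 1) (j : ℤ) : ∀ w ∈ 𝒜 j, LinearMap.mulLeft k ℓ w ∈ 𝒜 (j + 1) := by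
  intro w hw
  rw [add_comm]
  exact hB.mul_mem hℓ hw

theorem IsStdGradedArtinian.exists_eq_bot (hB : IsStdGradedArtinian k B 𝒜) :
    ∃ D : ℕ, ∀ j : ℤ, (D : ℤ) ≤ j → 𝒜 j = ⊥ := by
  have := hB.finiteDim
  have hfin : {j | 𝒜 j ≠ ⊥}.Finite :=
    WellFoundedGT.finite_ne_bot_of_iSupIndep hB.internal.submodule_iSupIndep
  obtain ⟨M, hM⟩ := hfin.bddAbove
  refine ⟨(M + 1).toNat, fun j hj => ?_⟩
  by_contra h
  have := hM h
  omega

theorem IsStdGradedArtinian.pow_mem (hB : IsStdGradedArtinian k B 𝒜) {ℓ : B}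
    (hℓ : ℓ ∈ 𝒜 1) (n : ℕ) : ℓ ^ n ∈ 𝒜 n := by
  induction n with
  | zero => simpa using hB.one_mem
  | succ n ih => rw [pow_succ]; exact_mod_cast hB.mul_mem ih hℓ

theorem IsStdGradedArtinian.isNilpotent (hB : IsStdGradedArtinian k B 𝒜) {ℓ : B}
    (hℓ : ℓ ∈ 𝒜 1) : IsNilpotent ℓ := by
  obtain ⟨D, hD⟩ := hB.exists_eq_bot
  have := hB.pow_mem hℓ D
  rw [hD D le_rfl] at this
  exact ⟨D, by simpa using this⟩

theorem IsStdGradedArtinian.exists_stringBasis (hB : IsStdGradedArtinian k B 𝒜) {ℓ : B}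
    (hℓ : ℓ ∈ 𝒜 1) :
    ∃ (ι : Type) (_ : Fintype ι), Nonempty (StringBasis 𝒜 (LinearMap.mulLeft k ℓ) ⊤ ι) := by
  have := hB.finiteDim
  obtain ⟨P, hP⟩ := hB.internal.exists_isGradedProj
  refine _root_.exists_stringBasis hP (hB.mulLeft_mem hℓ) ?_ ⊤ (fun _ _ => trivial)
    (fun _ _ _ => trivial)
  obtain ⟨n, hn⟩ := hB.isNilpotent hℓ
  exact ⟨n, by rw [LinearMap.pow_mulLeft, hn, LinearMap.mulLeft_zero_eq_zero]⟩

section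

variable {ι : Type} {ℓ : B} (b : StringBasis 𝒜 (LinearMap.mulLeft k ℓ) ⊤ ι)

theorem StringBasis.pow_gen_ne_zero {s : ι} {p : ℕ} (hp : p < b.len s) :
    (LinearMap.mulLeft k ℓ ^ p) (b.gen s) ≠ 0 :=
  b.linInd.ne_zero ⟨s, ⟨p, hp⟩⟩

theorem StringBasis.start_nonneg (hB : IsStdGradedArtinian k B 𝒜) (s : ι) : 0 ≤ b.start s := by
  by_contra h
  have h1 := b.gen_mem s
  rw [hB.neg_bot _ (not_le.mp h), Submodule.mem_bot] at h1
  exact b.pow_gen_ne_zero (b.len_pos s) (by simpa using h1)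

theorem StringBasis.start_add_len_le (hB : IsStdGradedArtinian k B 𝒜) (hℓ : ℓ ∈ 𝒜 1) {D : ℕ}
    (hD : ∀ j : ℤ, (D : ℤ) ≤ j → 𝒜 j = ⊥) (s : ι) : b.start s + b.len s ≤ D := by
  by_contra h
  have h0 := b.len_pos s
  have h1 := pow_mem_shift (hB.mulLeft_mem hℓ) (b.len s - 1) (b.gen_mem s)
  rw [hD _ (by omega), Submodule.mem_bot] at h1
  exact b.pow_gen_ne_zero (by omega) h1

theorem StringBasis.hilb_eq [Fintype ι] (hB : IsStdGradedArtinian k B 𝒜) (hℓ : ℓ ∈ 𝒜 1) (j : ℤ) :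
    hilb 𝒜 j =
      (Finset.univ.filter fun s => b.start s ≤ j ∧ j < b.start s + b.len s).card := by
  classical
  obtain ⟨P, hP⟩ := hB.internal.exists_isGradedProj
  let bas := Module.Basis.mk b.linInd b.span_eq.ge
  have hbas : ∀ t, bas t = (LinearMap.mulLeft k ℓ ^ (t.2 : ℕ)) (b.gen t.1) :=
    fun t => Module.Basis.mk_apply _ _ t
  have hli : LinearIndependent k
      (fun t : {t : Σ s, Fin (b.len s) // b.start t.1 + (t.2 : ℕ) = j} => bas t) :=
    bas.linearIndependent.comp _ Subtype.val_injective
  rw [hilb, hP.eq_span bas (fun t => b.start t.1 + (t.2 : ℕ))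
    (fun t => by rw [hbas]; exact pow_mem_shift (hB.mulLeft_mem hℓ) _ (b.gen_mem _)),
    finrank_span_eq_card hli,
    ← Fintype.card_coe]
  refine Fintype.card_congr
    { toFun := fun t => ⟨t.1.1, by
        have h1 := t.2
        have h2 := t.1.2.2
        simp only [Finset.mem_filter, Finset.mem_univ, true_and]
        omega⟩
      invFun := fun s => ⟨⟨s.1, ⟨(j - b.start s.1).toNat, by
        have := (Finset.mem_filter.mp s.2).2
        omega⟩⟩, by
        have := (Finset.mem_filter.mp s.2).2
        simp only
        omega⟩
      left_inv := ?_
      right_inv := fun s => rfl }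
  rintro ⟨⟨s, p⟩, rfl⟩
  simp

/-- The extension `B ⊗ k[x]/(x ^ d)` is a sum of tensor products of strings. -/
theorem StringBasis.exists_stringTensor [Fintype ι] (hB : IsStdGradedArtinian k B 𝒜)
    (hA : IsStdGradedArtinian k A ℬ) {φ : B →ₐ[k] A} {x : A} {d : ℕ}
    (hext : IsCIExtension 𝒜 ℬ φ x d) (hℓ : ℓ ∈ 𝒜 1) :
    ∃ T : StringTensor ℬ (LinearMap.mulLeft k (φ ℓ + x)) ι d,
      T.start = b.start ∧ T.len = b.len := by
  classical
  obtain ⟨P, hP⟩ := hA.internal.exists_isGradedProj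
  have hgen : ∀ s (p : ℕ), ℓ ^ p * b.gen s ∈ 𝒜 (b.start s + p) := by
    intro s p
    rw [add_comm]
    exact hB.mul_mem (hB.pow_mem hℓ p) (b.gen_mem s)
  have hbE : ∀ s (p : ℕ), (LinearMap.mulLeft k ℓ ^ p) (b.gen s) = ℓ ^ p * b.gen s := by
    intro s p
    rw [LinearMap.pow_mulLeft, LinearMap.mulLeft_apply]
  have hind := b.linInd
  have hspan := b.span_eq
  simp only [hbE] at hind hspan
  let vec : ι → ℕ → ℕ → A := fun s p q => x ^ q * φ (ℓ ^ p * b.gen s)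
  have hvec : ∀ s (p q : ℕ), vec s p q ∈ ℬ (b.start s + p + q) := by
    intro s p q
    rw [add_comm]
    exact hA.mul_mem (hA.pow_mem hext.x_mem q) (hext.map_mem _ _ (hgen s p))
  let fam : (Σ s, Fin (b.len s) × Fin d) → A := fun t => vec t.1 t.2.1 t.2.2
  have hli : LinearIndependent k fam := by
    rw [Fintype.linearIndependent_iff]
    intro g hg t
    set j : ℤ := b.start t.1 + (t.2.1 : ℕ) + (t.2.2 : ℕ) with hj
    let c : Fin d → (Σ s, Fin (b.len s)) → k := fun q u =>
      if b.start u.1 + (u.2 : ℕ) + (q : ℕ) = j then g ⟨u.1, u.2, q⟩ else 0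
    let f : Fin d → B := fun q => ∑ u : Σ s, Fin (b.len s), c q u • (ℓ ^ (u.2 : ℕ) * b.gen u.1)
    have hf : ∀ q : Fin d, f q ∈ 𝒜 (j - ((q : ℕ) : ℤ)) := by
      intro q
      refine Submodule.sum_mem _ fun u _ => ?_
      simp only [c]
      split_ifs with h
      · rw [← h, add_sub_cancel_right]
        exact Submodule.smul_mem _ _ (hgen _ _)
      · rw [zero_smul]
        exact zero_mem _
    have h0 : ∑ q : Fin d, x ^ (q : ℕ) * φ (f q) = 0 := by
      have h1 := congrArg (P j) hg
      rw [map_zero, map_sum] at h1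
      rw [← h1, Fintype.sum_sigma]
      simp only [f, map_sum, Finset.mul_sum, map_smul]
      rw [Finset.sum_comm, Fintype.sum_sigma]
      refine Finset.sum_congr rfl fun s _ => ?_
      rw [Fintype.sum_prod_type]
      refine Finset.sum_congr rfl fun p _ => Finset.sum_congr rfl fun q _ => ?_
      simp only [fam, c, hP.apply_of_mem (hvec s p q) j, vec]
      split_ifs <;> simp
    have h1 := hext.decomp_unique j f hf h0 t.2.2
    have h2 := (Fintype.linearIndependent_iff.mp hind) (c t.2.2) h1 ⟨t.1, t.2.1⟩
    simpa [c, hj] using h2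
  have hsp : ⊤ ≤ Submodule.span k (Set.range fam) := by
    have h1 : ∀ (q : Fin d) (w : B), x ^ (q : ℕ) * φ w ∈ Submodule.span k (Set.range fam) := by
      intro q w
      have hw : w ∈ Submodule.span k (Set.range fun t : Σ s, Fin (b.len s) =>
        ℓ ^ (t.2 : ℕ) * b.gen t.1) := by rw [hspan]; trivial
      induction hw using Submodule.span_induction with
      | mem _ h =>
        obtain ⟨u, rfl⟩ := h
        exact Submodule.subset_span ⟨⟨u.1, u.2, q⟩, rfl⟩
      | zero => simp
      | add y z _ _ hy hz => rw [map_add, mul_add]; exact add_mem hy hz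
      | smul c y _ hy => rw [map_smul, mul_smul_comm]; exact Submodule.smul_mem _ _ hy
    intro w _
    obtain ⟨S, hS⟩ := hP.exists_sum w
    rw [← hS]
    refine Submodule.sum_mem _ fun j _ => ?_
    obtain ⟨f, -, hf⟩ := hext.decomp_exists j _ (hP.mem j w)
    rw [hf]
    exact Submodule.sum_mem _ fun q _ => h1 q (f q)
  refine ⟨⟨b.start, b.len, vec, hvec, ?_, ?_, ?_, Module.Basis.mk hli hsp,
    fun t => Module.Basis.mk_apply _ _ t⟩, rfl, rfl⟩
  · intro s p q hp
    have h1 := b.pow_len s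
    rw [hbE] at h1
    simp only [vec]
    rw [← Nat.sub_add_cancel hp, pow_add, mul_assoc, h1, mul_zero, map_zero, mul_zero]
  · intro s p q hq
    simp only [vec]
    rw [← Nat.sub_add_cancel hq, pow_add, hext.x_pow, mul_zero, zero_mul]
  · intro s p q
    simp only [vec, LinearMap.mulLeft_apply, map_mul, map_pow]
    ring

end

theorem mulFullRank_pow_iff (V V' : Submodule k A) (L : A) (t : ℕ) :
    MulFullRank V V' (L ^ t) ↔
      (∀ w ∈ V, (LinearMap.mulLeft k L ^ t) w = 0 → w = 0) ∨
      (∀ w ∈ V', ∃ u ∈ V, (LinearMap.mulLeft k L ^ t) u = w) := by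
  simp only [LinearMap.pow_mulLeft, LinearMap.mulLeft_apply]
  rfl

theorem StringTensor.mulFullRank [CharZero k] {ι : Type} [Fintype ι] {L : A} {d : ℕ}
    (hA : IsStdGradedArtinian k A ℬ) (T : StringTensor ℬ (LinearMap.mulLeft k L) ι d)
    (hcen : ∀ s s', T.center s' ≤ T.center s + 1) (i : ℤ) (t : ℕ) :
    MulFullRank (ℬ i) (ℬ (i + t)) (L ^ t) := by
  obtain ⟨P, hP⟩ := hA.internal.exists_isGradedProj
  rw [mulFullRank_pow_iff]
  by_cases h : ∀ s, 2 * i + t ≤ T.center s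
  · exact Or.inl fun w hw h0 => T.pow_injective hP h hw h0
  · right
    push Not at h
    obtain ⟨s, hs⟩ := h
    refine fun w hw => T.pow_surjective hP (fun s' => ?_) hw
    have := hcen s s'
    omega

theorem StringTensor.pieceDim_le_or_le {ι : Type} {L : A} {d : ℕ}
    (hA : IsStdGradedArtinian k A ℬ) (T : StringTensor ℬ (LinearMap.mulLeft k L) ι d) {i : ℤ}
    {t : ℕ} (h : MulFullRank (ℬ i) (ℬ (i + t)) (L ^ t)) :
    (∀ s, T.pieceDim s i ≤ T.pieceDim s (i + t)) ∨
      (∀ s, T.pieceDim s (i + t) ≤ T.pieceDim s i) := by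
  obtain ⟨P, hP⟩ := hA.internal.exists_isGradedProj
  have := hA.finiteDim
  rw [mulFullRank_pow_iff] at h
  exact h.imp (fun h s => T.pieceDim_le_of_injective h s)
    (fun h s => T.pieceDim_le_of_surjective hP h s)

end Extension
section Centers

variable {k B : Type*} [Field k] [CommRing B] [Algebra k B] {𝒜 : ℤ → Submodule k B} {ι : Type}
  [Fintype ι] {ℓ : B} (b : StringBasis 𝒜 (LinearMap.mulLeft k ℓ) ⊤ ι)

theorem StringBasis.exists_of_hilb_lt (hB : IsStdGradedArtinian k B 𝒜) (hℓ : ℓ ∈ 𝒜 1) {i j : ℤ}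
    (h : hilb 𝒜 i < hilb 𝒜 j) :
    ∃ s, (b.start s ≤ j ∧ j < b.start s + b.len s) ∧
      ¬ (b.start s ≤ i ∧ i < b.start s + b.len s) := by
  by_contra! hc
  refine h.not_ge ?_
  rw [b.hilb_eq hB hℓ, b.hilb_eq hB hℓ]
  exact Finset.card_le_card (Finset.monotone_filter_right _ fun s _ hs => hc s hs)

theorem StringBasis.hilb_lt (hB : IsStdGradedArtinian k B 𝒜) (hℓ : ℓ ∈ 𝒜 1) {i j : ℤ}
    (h : ∀ s, b.start s ≤ i → i < b.start s + b.len s → b.start s ≤ j ∧ j < b.start s + b.len s)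
    {s : ι} (hj : b.start s ≤ j ∧ j < b.start s + b.len s)
    (hi : ¬ (b.start s ≤ i ∧ i < b.start s + b.len s)) : hilb 𝒜 i < hilb 𝒜 j := by
  rw [b.hilb_eq hB hℓ, b.hilb_eq hB hℓ]
  refine Finset.card_lt_card ((Finset.ssubset_iff_of_subset
    (Finset.monotone_filter_right _ fun u _ hu => h u hu.1 hu.2)).mpr ⟨s, ?_, ?_⟩)
  · simpa using hj
  · simpa using hi

theorem StringBasis.almostCentered (hB : IsStdGradedArtinian k B 𝒜) (hℓ : ℓ ∈ 𝒜 1)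
    (hcen : ∀ s s', 2 * b.start s' + b.len s' ≤ 2 * b.start s + b.len s + 1) :
    AlmostCentered 𝒜 := by
  refine fun i j hij => ⟨fun h n => ?_, fun h n => ?_⟩ <;> by_contra! hn <;>
    obtain ⟨s, hs⟩ := b.exists_of_hilb_lt hB hℓ h <;>
    obtain ⟨s', hs'⟩ := b.exists_of_hilb_lt hB hℓ hn
  · have := hcen s' s
    omega
  · have := hcen s s'
    omega

theorem AlmostCentered.center_le (hAC : AlmostCentered 𝒜) (hB : IsStdGradedArtinian k B 𝒜)
    (hℓ : ℓ ∈ 𝒜 1)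
    (hchain : ∀ s s', b.start s < b.start s' → b.start s' + b.len s' ≤ b.start s + b.len s)
    (s s' : ι) : 2 * b.start s' + b.len s' ≤ 2 * b.start s + b.len s + 1 := by
  by_contra! hc
  have hs := b.len_pos s
  have hs' := b.len_pos s'
  rcases lt_or_ge (b.start s) (b.start s') with h | h
  · have h1 := hchain s s' h
    refine ((hAC (b.start s' - 1) (b.start s' + b.len s' - 1) (by omega)).1
      (b.hilb_lt hB hℓ (s := s') (fun u _ _ => ?_) (by omega) (by omega))
      (b.start s + b.len s - b.start s' - b.len s' + 1).toNat).not_gt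
      (b.hilb_lt hB hℓ (s := s) (fun u _ _ => ?_) (by omega) (by omega))
    · have := hchain u s'
      omega
    · have := hchain s u
      omega
  · refine ((hAC (b.start s) (b.start s + b.len s) (by omega)).2
      (b.hilb_lt hB hℓ (s := s) (fun u _ _ => ?_) (by omega) (by omega))
      (b.start s - b.start s' + 1).toNat).not_gt
      (b.hilb_lt hB hℓ (s := s') (fun u _ _ => ?_) (by omega) (by omega))
    · have := hchain s u
      omega
    · have := hchain u s'
      omega

theorem isCIExtension_id (𝒜 : ℤ → Submodule k B) : IsCIExtension 𝒜 𝒜 (AlgHom.id k B) 0 1 where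
  map_mem _ _ h := h
  x_mem := zero_mem _
  x_pow := by simp
  decomp_mem j f h := by simpa using h 0
  decomp_exists j c hc := ⟨fun _ => c, by simpa using hc, by simp⟩
  decomp_unique j f _ h q := by
    rw [Subsingleton.elim q 0]
    simpa using h

theorem StringBasis.chain (hB : IsStdGradedArtinian k B 𝒜) (hℓ : ℓ ∈ 𝒜 1)
    (hfull : ∀ i : ℤ, 0 ≤ i → ∀ t : ℕ, 1 ≤ t → MulFullRank (𝒜 i) (𝒜 (i + t)) (ℓ ^ t)) (s s' : ι)
    (h : b.start s < b.start s') : b.start s' + b.len s' ≤ b.start s + b.len s := by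
  by_contra! hc
  obtain ⟨T, hT, hT'⟩ := b.exists_stringTensor hB hB (isCIExtension_id 𝒜) hℓ
  have hs := b.len_pos s
  have hs' := b.len_pos s'
  have h0 := b.start_nonneg hB s
  set t : ℕ := (b.start s' + b.len s' - 1 - b.start s).toNat with ht
  have h1 := hfull (b.start s) h0 t (by omega)
  rcases T.pieceDim_le_or_le hB (t := t) (i := b.start s) (by simpa using h1) with h2 | h2
  · have := h2 s
    simp only [StringTensor.pieceDim, hT, hT'] at this
    omega
  · have := h2 s'
    simp only [StringTensor.pieceDim, hT, hT'] at this
    omega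

theorem AlmostCentered.hasSLP_extension [CharZero k] {A : Type*} [CommRing A] [Algebra k A]
    {ℬ : ℤ → Submodule k A} {φ : B →ₐ[k] A} {x : A} {d : ℕ} (hAC : AlmostCentered 𝒜)
    (hSLP : HasSLP 𝒜) (hB : IsStdGradedArtinian k B 𝒜) (hA : IsStdGradedArtinian k A ℬ)
    (hext : IsCIExtension 𝒜 ℬ φ x d) : HasSLP ℬ := by
  obtain ⟨ℓ, hℓ, hfull⟩ := hSLP
  obtain ⟨ι, _, ⟨b⟩⟩ := hB.exists_stringBasis hℓ
  obtain ⟨T, hT, hT'⟩ := b.exists_stringTensor hB hA hext hℓ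
  refine ⟨φ ℓ + x, add_mem (hext.map_mem _ _ hℓ) hext.x_mem, fun i _ t _ =>
    T.mulFullRank hA (fun s s' => ?_) i t⟩
  have := hAC.center_le b hB hℓ (b.chain hB hℓ hfull) s s'
  simp only [StringTensor.center, hT, hT']
  omega

end Centers

section Necessity

variable {k B A : Type*} [Field k] [CommRing B] [Algebra k B] [CommRing A] [Algebra k A]
  {𝒜 : ℤ → Submodule k B} {ℬ : ℤ → Submodule k A} {φ : B →ₐ[k] A} {x : A} {d : ℕ}

theorem MulFullRank.of_smul {V V' : Submodule k A} {a : A} {c : k}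
    (h : MulFullRank V V' (c • a)) : MulFullRank V V' a := by
  refine h.imp (fun h v hv h0 => h v hv (by rw [smul_mul_assoc, h0, smul_zero])) fun h w hw => ?_
  obtain ⟨v, hv, rfl⟩ := h w hw
  exact ⟨c • v, Submodule.smul_mem _ _ hv, by rw [smul_mul_assoc, mul_smul_comm]⟩

theorem IsCIExtension.eq_zero_of_mul_eq_zero (hext : IsCIExtension 𝒜 ℬ φ x d) {q : ℕ} (hq : q < d)
    {n : ℤ} {w : B} (hw : w ∈ 𝒜 n) (h : x ^ q * φ w = 0) : w = 0 := by
  have h1 := hext.decomp_unique (n + q) (fun p => if (p : ℕ) = q then w else 0) (fun p => ?_) ?_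
    ⟨q, hq⟩
  · simpa using h1
  · split_ifs with hp
    · rw [hp, add_sub_cancel_right]
      exact hw
    · exact zero_mem _
  · rw [← h, Finset.sum_eq_single ⟨q, hq⟩]
    · simp
    · intro p _ hp
      rw [if_neg (fun hpq => hp (Fin.ext hpq)), map_zero, mul_zero]
    · simp

theorem IsCIExtension.exists_eq_add_smul (hext : IsCIExtension 𝒜 ℬ φ x d)
    (hB : IsStdGradedArtinian k B 𝒜) (hd : 2 ≤ d) {L : A} (hL : L ∈ ℬ 1) :
    ∃ ℓ ∈ 𝒜 1, ∃ c : k, L = φ ℓ + c • x := by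
  obtain ⟨e, rfl⟩ := Nat.exists_eq_add_of_le' hd
  obtain ⟨f, hf, rfl⟩ := hext.decomp_exists 1 L hL
  have h1 := hf 1
  simp only [Fin.val_one, Nat.cast_one, sub_self, hB.zero_spanOne,
    Submodule.mem_span_singleton] at h1
  obtain ⟨c, hc⟩ := h1
  refine ⟨f 0, by simpa using hf 0, c, ?_⟩
  rw [Fin.sum_univ_succ, Fin.sum_univ_succ, Finset.sum_eq_zero]
  · simp [← hc]
  · intro q _
    have h2 := hf q.succ.succ
    rw [hB.neg_bot _ (by simp only [Fin.val_succ]; omega), Submodule.mem_bot] at h2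
    rw [h2, map_zero, mul_zero]

theorem IsCIExtension.not_mulFullRank (hext : IsCIExtension 𝒜 ℬ φ x d)
    (hB : IsStdGradedArtinian k B 𝒜) (hA : IsStdGradedArtinian k A ℬ) (hd : 2 ≤ d) [Nontrivial B]
    {ℓ : B} (hℓ : ℓ ∈ 𝒜 1) : ∃ t : ℕ, 1 ≤ t ∧ ¬ MulFullRank (ℬ 0) (ℬ t) (φ ℓ ^ t) := by
  classical
  have hnil := hB.isNilpotent hℓ
  have hpos := pos_nilpotencyClass_iff.mpr hnil
  set n := nilpotencyClass ℓ with hn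
  have hzero : φ ℓ ^ n = 0 := by rw [← map_pow, pow_nilpotencyClass hnil, map_zero]
  refine ⟨n, hpos, ?_⟩
  rintro (h | h)
  · have h1 := h 1 hA.one_mem (by rw [hzero, zero_mul])
    exact one_ne_zero
      (hext.eq_zero_of_mul_eq_zero (by omega) hB.one_mem (q := 0) (by simpa using h1))
  · have hm := hA.mul_mem hext.x_mem (hext.map_mem _ _ (hB.pow_mem hℓ (n - 1)))
    obtain ⟨v, -, hv⟩ := h (x * φ (ℓ ^ (n - 1))) (by convert hm; omega)
    rw [hzero, zero_mul] at hv
    exact pow_pred_nilpotencyClass hnil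
      (hext.eq_zero_of_mul_eq_zero (q := 1) (by omega) (hB.pow_mem hℓ (n - 1))
        (by simpa using hv.symm))

/-- A strong Lefschetz element of the extension can be normalized to have `x`-coefficient `1`. -/
theorem HasSLP.exists_add (h : HasSLP ℬ) (hext : IsCIExtension 𝒜 ℬ φ x d)
    (hB : IsStdGradedArtinian k B 𝒜) (hA : IsStdGradedArtinian k A ℬ) (hd : 2 ≤ d) [Nontrivial B] :
    ∃ ℓ ∈ 𝒜 1, ∀ i : ℤ, 0 ≤ i → ∀ t : ℕ, 1 ≤ t →
      MulFullRank (ℬ i) (ℬ (i + t)) ((φ ℓ + x) ^ t) := by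
  obtain ⟨L, hL, hfull⟩ := h
  obtain ⟨ℓ, hℓ, c, rfl⟩ := hext.exists_eq_add_smul hB hd hL
  rcases eq_or_ne c 0 with rfl | hc
  · obtain ⟨t, ht, hnot⟩ := hext.not_mulFullRank hB hA hd hℓ
    exact absurd (by simpa using hfull 0 le_rfl t ht) hnot
  · refine ⟨c⁻¹ • ℓ, Submodule.smul_mem _ _ hℓ, fun i hi t ht =>
      MulFullRank.of_smul (c := c ^ t) ?_⟩
    rw [← smul_pow, smul_add, map_smul, smul_inv_smul₀ hc]
    exact hfull i hi t ht

theorem HasSLP.almostCentered (h : HasSLP ℬ) (hB : IsStdGradedArtinian k B 𝒜)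
    (hA : IsStdGradedArtinian k A ℬ) {D : ℕ} (hD : ∀ j : ℤ, (D : ℤ) ≤ j → 𝒜 j = ⊥)
    (hext : IsCIExtension 𝒜 ℬ φ x (2 * D + 2)) [Nontrivial B] : AlmostCentered 𝒜 := by
  obtain ⟨ℓ, hℓ, hfull⟩ := h.exists_add hext hB hA (by omega)
  obtain ⟨ι, _, ⟨b⟩⟩ := hB.exists_stringBasis hℓ
  obtain ⟨T, hT, hT'⟩ := b.exists_stringTensor hB hA hext hℓ
  refine b.almostCentered hB hℓ fun s s' => ?_
  by_contra! hc
  have h1 := b.len_pos s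
  have h2 := b.len_pos s'
  have h3 := b.start_nonneg hB s
  have h4 := b.start_nonneg hB s'
  have h5 := b.start_add_len_le hB hℓ hD s
  have h6 := b.start_add_len_le hB hℓ hD s'
  obtain ⟨i, hi⟩ : ∃ i : ℤ, i = if b.start s + b.len s < b.start s' then b.start s
    else max (b.start s) (b.start s' - 1) := ⟨_, rfl⟩
  obtain ⟨t, ht⟩ : ∃ t : ℕ, i + t = 2 * b.start s + b.len s - 1 + (2 * D + 2) - i :=
    ⟨(2 * b.start s + b.len s - 1 + (2 * D + 2) - 2 * i).toNat, by split_ifs at hi <;> omega⟩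
  have hi' : b.start s ≤ i ∧ i ≤ D := by split_ifs at hi <;> omega
  rcases T.pieceDim_le_or_le hA (hfull i (by omega) t (by omega)) with h7 | h7
  · have h8 := h7 s
    simp only [StringTensor.pieceDim, hT, hT', ht] at h8
    push_cast at h8
    split_ifs at hi <;> omega
  · have h8 := h7 s'
    simp only [StringTensor.pieceDim, hT, hT', ht] at h8
    push_cast at h8
    split_ifs at hi <;> omega

end Necessity

section PowerBasis

variable {k B A : Type*} [Field k] [CommRing B] [Algebra k B] [CommRing A] [Algebra k A]
  [Algebra B A] [IsScalarTower k B A] {𝒜 : ℤ → Submodule k B} {d : ℕ} {x : A}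

/-- The grading on `A = ⊕ x ^ q B` for which `x` has degree one. -/
noncomputable def shiftGrading (𝒜 : ℤ → Submodule k B) (pb : Module.Basis (Fin d) B A) (j : ℤ) :
    Submodule k A :=
  ⨅ q : Fin d, (𝒜 (j - (q : ℕ))).comap ((pb.coord q).restrictScalars k)

variable {pb : Module.Basis (Fin d) B A}

theorem mem_shiftGrading {j : ℤ} {a : A} :
    a ∈ shiftGrading 𝒜 pb j ↔ ∀ q : Fin d, pb.repr a q ∈ 𝒜 (j - (q : ℕ)) := by
  simp [shiftGrading]

theorem sum_pow_mul_repr (hpb : ∀ q : Fin d, pb q = x ^ (q : ℕ)) (a : A) :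
    ∑ q : Fin d, x ^ (q : ℕ) * algebraMap B A (pb.repr a q) = a := by
  conv_rhs => rw [← pb.sum_repr a]
  refine Finset.sum_congr rfl fun q _ => ?_
  rw [hpb, Algebra.smul_def, mul_comm]

theorem pow_mul_mem_shiftGrading (hpb : ∀ q : Fin d, pb q = x ^ (q : ℕ)) (hx : x ^ d = 0)
    {n : ℤ} {w : B} (hw : w ∈ 𝒜 n) (q : ℕ) :
    x ^ q * algebraMap B A w ∈ shiftGrading 𝒜 pb (n + q) := by
  rcases lt_or_ge q d with hq | hq
  · rw [mem_shiftGrading]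
    intro p
    rw [mul_comm, ← Algebra.smul_def, ← hpb ⟨q, hq⟩, map_smul, Module.Basis.repr_self,
      Finsupp.smul_apply, Finsupp.single_apply]
    split_ifs with h
    · subst h
      simpa using hw
    · simp
  · rw [pow_eq_zero_of_le hq hx, zero_mul]
    exact zero_mem _

theorem isInternal_shiftGrading (hB : IsStdGradedArtinian k B 𝒜)
    (hpb : ∀ q : Fin d, pb q = x ^ (q : ℕ)) (hx : x ^ d = 0) :
    DirectSum.IsInternal (shiftGrading 𝒜 pb) := by
  obtain ⟨hind, htop⟩ :=
    (DirectSum.isInternal_submodule_iff_iSupIndep_and_iSup_eq_top 𝒜).mp hB.internal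
  refine (DirectSum.isInternal_submodule_iff_iSupIndep_and_iSup_eq_top _).mpr ⟨?_, ?_⟩
  · refine iSupIndep_def.mpr fun i => Submodule.disjoint_def.mpr fun a ha ha' => ?_
    refine pb.ext_elem fun q => ?_
    rw [map_zero, Finsupp.zero_apply]
    refine Submodule.disjoint_def.mp (iSupIndep_def.mp hind (i - (q : ℕ))) _
      (mem_shiftGrading.mp ha q) ?_
    have hle : ⨆ j, ⨆ (_ : j ≠ i), shiftGrading 𝒜 pb j ≤
        (⨆ n, ⨆ (_ : n ≠ i - (q : ℕ)), 𝒜 n).comap ((pb.coord q).restrictScalars k) := by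
      refine iSup₂_le fun j hj w hw => ?_
      have hne : j - ((q : ℕ) : ℤ) ≠ i - (q : ℕ) := by omega
      exact Submodule.mem_iSup_of_mem _ (Submodule.mem_iSup_of_mem hne (mem_shiftGrading.mp hw q))
    exact hle ha'
  · refine eq_top_iff.mpr fun a _ => ?_
    rw [← sum_pow_mul_repr hpb a]
    refine Submodule.sum_mem _ fun q _ => ?_
    have hw : pb.repr a q ∈ ⨆ n, 𝒜 n := htop ▸ Submodule.mem_top
    generalize pb.repr a q = w at hw ⊢
    induction hw using Submodule.iSup_induction' with
    | mem n w hw =>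
      exact Submodule.mem_iSup_of_mem _ (pow_mul_mem_shiftGrading hpb hx hw q)
    | zero => simp
    | add y z _ _ hy hz => rw [map_add, mul_add]; exact add_mem hy hz

theorem isStdGradedArtinian_shiftGrading (hB : IsStdGradedArtinian k B 𝒜)
    (hpb : ∀ q : Fin d, pb q = x ^ (q : ℕ)) (hx : x ^ d = 0) :
    IsStdGradedArtinian k A (shiftGrading 𝒜 pb) := by
  have hmem := fun {n : ℤ} {w : B} (hw : w ∈ 𝒜 n) q => pow_mul_mem_shiftGrading hpb hx hw q
  have hx1 : x ∈ shiftGrading 𝒜 pb 1 := by simpa using hmem hB.one_mem 1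
  have hone : (1 : A) ∈ shiftGrading 𝒜 pb 0 := by simpa using hmem hB.one_mem 0
  have hmul : ∀ {i j : ℤ} {a b : A}, a ∈ shiftGrading 𝒜 pb i → b ∈ shiftGrading 𝒜 pb j →
      a * b ∈ shiftGrading 𝒜 pb (i + j) := by
    intro i j a b ha hb
    rw [← sum_pow_mul_repr hpb a, ← sum_pow_mul_repr hpb b, Finset.sum_mul_sum]
    refine Submodule.sum_mem _ fun p _ => Submodule.sum_mem _ fun q _ => ?_
    convert hmem (hB.mul_mem (mem_shiftGrading.mp ha p) (mem_shiftGrading.mp hb q))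
      ((p : ℕ) + (q : ℕ)) using 1
    · congr 1
      push_cast
      ring
    · rw [map_mul]
      ring
  have hneg : ∀ i : ℤ, i < 0 → shiftGrading 𝒜 pb i = ⊥ := by
    refine fun i hi => (Submodule.eq_bot_iff _).mpr fun a ha => pb.ext_elem fun q => ?_
    have h1 := mem_shiftGrading.mp ha q
    rw [hB.neg_bot _ (by omega), Submodule.mem_bot] at h1
    simpa using h1
  refine ⟨isInternal_shiftGrading hB hpb hx, hone, hmul, hneg, ?_, ?_, ?_⟩
  · refine le_antisymm (fun a ha => ?_) (by simpa [Submodule.span_le] using hone)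
    rw [← sum_pow_mul_repr hpb a]
    refine Submodule.sum_mem _ fun q _ => ?_
    have h1 := mem_shiftGrading.mp ha q
    rcases Nat.eq_zero_or_pos (q : ℕ) with hq | hq
    · rw [hq, Nat.cast_zero, sub_zero, hB.zero_spanOne, Submodule.mem_span_singleton] at h1
      obtain ⟨c, hc⟩ := h1
      refine Submodule.mem_span_singleton.mpr ⟨c, ?_⟩
      rw [← hc, hq, pow_zero, one_mul, Algebra.algebraMap_eq_smul_one, smul_assoc, one_smul]
    · rw [hB.neg_bot _ (by omega), Submodule.mem_bot] at h1
      simp [h1]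
  · refine fun i hi => le_antisymm (fun a ha => ?_) (Submodule.mul_le.mpr fun a ha b hb => ?_)
    · rw [← sum_pow_mul_repr hpb a]
      refine Submodule.sum_mem _ fun q _ => ?_
      have h1 := mem_shiftGrading.mp ha q
      rcases Nat.eq_zero_or_pos (q : ℕ) with hq | hq
      · rw [hq, Nat.cast_zero, sub_zero, hB.succ_eq i hi] at h1
        rw [hq, pow_zero, one_mul]
        generalize pb.repr a q = w at h1 ⊢
        induction h1 using Submodule.mul_induction_on' with
        | mem_mul_mem y hy z hz =>
          rw [map_mul]
          exact Submodule.mul_mem_mul (by simpa using hmem hy 0) (by simpa using hmem hz 0)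
        | add y _ z _ hy hz => rw [map_add]; exact add_mem hy hz
      · obtain ⟨p, hp⟩ := Nat.exists_eq_add_of_le' hq
        rw [hp, pow_succ', mul_assoc]
        refine Submodule.mul_mem_mul hx1 ?_
        convert hmem h1 p using 2
        rw [hp]
        push_cast
        ring
    · rw [add_comm]
      exact hmul ha hb
  · have := hB.finiteDim
    have : Module.Finite B A := Module.Finite.of_basis pb
    exact Module.Finite.trans B A

theorem isCIExtension_shiftGrading (hB : IsStdGradedArtinian k B 𝒜)
    (hpb : ∀ q : Fin d, pb q = x ^ (q : ℕ)) (hx : x ^ d = 0) :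
    IsCIExtension 𝒜 (shiftGrading 𝒜 pb) (IsScalarTower.toAlgHom k B A) x d where
  map_mem j b hb := by simpa using pow_mul_mem_shiftGrading hpb hx hb 0
  x_mem := by simpa using pow_mul_mem_shiftGrading hpb hx hB.one_mem 1
  x_pow := hx
  decomp_mem j f hf := Submodule.sum_mem _ fun q _ => by
    simpa using pow_mul_mem_shiftGrading hpb hx (hf q) q
  decomp_exists j c hc := ⟨fun q => pb.repr c q, mem_shiftGrading.mp hc,
    (sum_pow_mul_repr hpb c).symm⟩
  decomp_unique j f _ h := by
    refine Fintype.linearIndependent_iff.mp pb.linearIndependent f ?_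
    rw [← h]
    refine Finset.sum_congr rfl fun q _ => ?_
    rw [hpb, Algebra.smul_def, mul_comm]
    rfl

end PowerBasis

theorem IsStdGradedArtinian.exists_isCIExtension {k : Type*} {B : Type} [Field k] [CommRing B]
    [Algebra k B] [Nontrivial B] {𝒜 : ℤ → Submodule k B} (hB : IsStdGradedArtinian k B 𝒜)
    (d : ℕ) :
    ∃ (A : Type) (_ : CommRing A) (_ : Algebra k A) (ℬ : ℤ → Submodule k A) (φ : B →ₐ[k] A)
      (x : A), IsStdGradedArtinian k A ℬ ∧ IsCIExtension 𝒜 ℬ φ x d := by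
  let g : Polynomial B := Polynomial.X ^ d
  have hg : g.Monic := Polynomial.monic_X_pow d
  let pb : Module.Basis (Fin d) B (AdjoinRoot g) :=
    (AdjoinRoot.powerBasisAux' hg).reindex (finCongr (Polynomial.natDegree_X_pow d))
  have hpb : ∀ q : Fin d, pb q = AdjoinRoot.root g ^ (q : ℕ) := by
    intro q
    rw [Module.Basis.reindex_apply]
    exact (AdjoinRoot.powerBasis' hg).basis_eq_pow _
  have hx : AdjoinRoot.root g ^ d = 0 := by
    rw [← AdjoinRoot.mk_X, ← map_pow]
    exact AdjoinRoot.mk_self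
  exact ⟨AdjoinRoot g, inferInstance, inferInstance, shiftGrading 𝒜 pb,
    IsScalarTower.toAlgHom k B _, AdjoinRoot.root g,
    isStdGradedArtinian_shiftGrading hB hpb hx, isCIExtension_shiftGrading hB hpb hx⟩

theorem almostCentered_of_subsingleton {k B : Type*} [Field k] [CommRing B] [Algebra k B]
    [Subsingleton B] (𝒜 : ℤ → Submodule k B) : AlmostCentered 𝒜 := by
  have h : ∀ i, hilb 𝒜 i = 0 := fun i => Module.finrank_zero_of_subsingleton
  intro i j _
  simp [h]

/-- Over a field `k` of characteristic zero, a standard graded artinian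
`k`-algebra `B` is such that `B ⊗ₖ k[x]/(x^d)` has the strong Lefschetz property for every
`d ≥ 1` if and only if `B` is almost centered and has the strong Lefschetz property. -/
theorem statement_15 {k B : Type} [Field k] [CharZero k]
    [CommRing B] [Algebra k B]
    (𝒜 : ℤ → Submodule k B) (hB : IsStdGradedArtinian k B 𝒜) :
    (∀ (d : ℕ), 1 ≤ d →
      ∀ (A : Type) [CommRing A] [Algebra k A],
        ∀ (ℬ : ℤ → Submodule k A) (φ : B →ₐ[k] A) (x : A),
          IsStdGradedArtinian k A ℬ → IsCIExtension 𝒜 ℬ φ x d → HasSLP ℬ) ↔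
      (AlmostCentered 𝒜 ∧ HasSLP 𝒜) := by
  refine ⟨fun h => ⟨?_, h 1 le_rfl B 𝒜 _ 0 hB (isCIExtension_id 𝒜)⟩,
    fun ⟨hAC, hSLP⟩ d _ A _ _ ℬ φ x hA hext => hAC.hasSLP_extension hSLP hB hA hext⟩
  cases subsingleton_or_nontrivial B
  · exact almostCentered_of_subsingleton 𝒜
  · obtain ⟨D, hD⟩ := hB.exists_eq_bot
    obtain ⟨A, _, _, ℬ, φ, x, hA, hext⟩ := hB.exists_isCIExtension (2 * D + 2)
    exact (h (2 * D + 2) (by omega) A ℬ φ x hA hext).almostCentered hB hA hD hext
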